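/- Define f : (0,∞) → ℝ by f(λ) = 2λ·e^{−2λ} + e^{−λ}·√(3e^{−λ} + 1)·Σ_{k=2}^{∞} λᵏ√k / k!. Then f(λ) ≤ λ for every λ ∈ (4/3, ∞). -/

import Mathlib

/-- The series `∑_{k=2}^∞ λᵏ √k / k!`. -/
noncomputable def erSeries (l : ℝ) : ℝ :=
  ∑' k : ℕ, l ^ (k + 2) * Real.sqrt ((k : ℝ) + 2) / (Nat.factorial (k + 2) : ℝ)

/-- The asymptotic bound `f(λ) = 2λe^{-2λ} + e^{-λ}√(3e^{-λ}+1) ∑_{k=2}^∞ λᵏ√k/k!`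
for the energy per vertex of a sparse Erdős–Rényi graph. -/
noncomputable def erBound (l : ℝ) : ℝ :=
  2 * l * Real.exp (-2 * l) +
    Real.exp (-l) * Real.sqrt (3 * Real.exp (-l) + 1) * erSeries l

theorem hasSum_pow_add_one_div_factorial (x : ℝ) :
    HasSum (fun k : ℕ => x ^ (k + 1) / ((k + 1).factorial : ℝ)) (Real.exp x - 1) := by
  have h : HasSum (fun k : ℕ => x ^ k / (k.factorial : ℝ)) (Real.exp x) := by
    rw [Real.exp_eq_exp_ℝ]
    exact NormedSpace.expSeries_div_hasSum_exp x
  simpa using (hasSum_nat_add_iff' 1).mpr h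

theorem sqrt_le_three_quarters_mul {x : ℝ} (hx : 2 ≤ x) : Real.sqrt x ≤ 3 / 4 * x := by
  rw [Real.sqrt_le_left (by linarith)]
  nlinarith

theorem erSeries_le {l : ℝ} (hl : 0 ≤ l) : erSeries l ≤ 3 / 4 * l * (Real.exp l - 1) := by
  have hs := (hasSum_pow_add_one_div_factorial l).mul_left (3 / 4 * l)
  have hle : ∀ k : ℕ, l ^ (k + 2) * Real.sqrt ((k : ℝ) + 2) / ((k + 2).factorial : ℝ) ≤
      3 / 4 * l * (l ^ (k + 1) / ((k + 1).factorial : ℝ)) := by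
    intro k
    have hk : Real.sqrt ((k : ℝ) + 2) ≤ 3 / 4 * ((k : ℝ) + 2) :=
      sqrt_le_three_quarters_mul (by linarith [k.cast_nonneg (α := ℝ)])
    calc l ^ (k + 2) * Real.sqrt ((k : ℝ) + 2) / ((k + 2).factorial : ℝ)
        ≤ l ^ (k + 2) * (3 / 4 * ((k : ℝ) + 2)) / ((k + 2).factorial : ℝ) := by gcongr
      _ = 3 / 4 * l * (l ^ (k + 1) / ((k + 1).factorial : ℝ)) := by
        have hf : ((k + 1).factorial : ℝ) ≠ 0 := by positivity
        have hk2 : (k : ℝ) + 2 ≠ 0 := by positivity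
        rw [Nat.factorial_succ (k + 1)]
        push_cast
        rw [show (k : ℝ) + 1 + 1 = k + 2 by ring]
        field_simp
        ring
  have hsum : Summable fun k : ℕ =>
      l ^ (k + 2) * Real.sqrt ((k : ℝ) + 2) / ((k + 2).factorial : ℝ) :=
    hs.summable.of_nonneg_of_le (fun k => by positivity) hle
  exact hasSum_le hle hsum.hasSum hs

theorem exp_neg_le_one_third {l : ℝ} (hl : 4 / 3 ≤ l) : Real.exp (-l) ≤ 1 / 3 := by
  have h := Real.quadratic_le_exp_of_nonneg (x := l) (by linarith)
  rw [Real.exp_neg, ← one_div]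
  exact one_div_le_one_div_of_le (by norm_num) (by nlinarith)

/-- `f(λ) ≤ λ` for every `λ ∈ (4/3, ∞)`. -/
theorem erBound_le_self : ∀ l ∈ Set.Ioi ((4 : ℝ) / 3), erBound l ≤ l := by
  intro l hl
  have hl : 4 / 3 < l := hl
  have hl0 : 0 ≤ l := by linarith
  unfold erBound
  have hq := exp_neg_le_one_third hl.le
  have hq0 := Real.exp_pos (-l)
  have hmul : Real.exp (-l) * Real.exp l = 1 := by rw [← Real.exp_add]; simp
  have hsq : Real.exp (-2 * l) = Real.exp (-l) ^ 2 := by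
    rw [← Real.exp_nat_mul]; congr 1; push_cast; ring
  rw [hsq]
  have hS := erSeries_le hl0
  generalize Real.exp (-l) = q at *
  have hr : Real.sqrt (3 * q + 1) ≤ 1 + 3 / 2 * q := by
    rw [Real.sqrt_le_left (by linarith)]
    nlinarith
  have hqS : q * erSeries l ≤ 3 / 4 * l * (1 - q) := by
    calc q * erSeries l ≤ q * (3 / 4 * l * (Real.exp l - 1)) := by gcongr
      _ = 3 / 4 * l * (1 - q) := by linear_combination 3 / 4 * l * hmul
  have hq1 : 0 ≤ 1 - q := by linarith
  calc 2 * l * q ^ 2 + q * Real.sqrt (3 * q + 1) * erSeries l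
      = 2 * l * q ^ 2 + Real.sqrt (3 * q + 1) * (q * erSeries l) := by ring
    _ ≤ 2 * l * q ^ 2 + Real.sqrt (3 * q + 1) * (3 / 4 * l * (1 - q)) := by gcongr
    _ ≤ 2 * l * q ^ 2 + (1 + 3 / 2 * q) * (3 / 4 * l * (1 - q)) := by gcongr
    _ = l * (3 / 4 + 3 / 8 * q + 7 / 8 * q ^ 2) := by ring
    _ ≤ l * 1 := by gcongr; nlinarith
    _ = l := mul_one l
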